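/- Let d ≥ 1, let P⁰, P¹ be d×d row-stochastic matrices, R⁰, R¹ ∈ ℝ^d, α ∈ [0,1], and T ≥ 1. Then the optimal value V_rel(·, T) of the finite-horizon relaxed LP, viewed as a function of the initial configuration, is Lipschitz continuous on Δ^d: there exists a constant K > 0 (depending on d, T, P⁰, P¹, R⁰, R¹, α) such that |V_rel(m, T) − V_rel(m', T)| ≤ K ‖m − m'‖₁ for all m, m' ∈ Δ^d. -/

import Mathlib

/-- The feasible region of the finite-horizon relaxed LP of the restless bandit with
transition matrices `P`, activation fraction `α`, initial configuration `m` and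
horizon `T`. -/
def rbFeasible (d T : ℕ) (P : Fin 2 → Matrix (Fin d) (Fin d) ℝ) (α : ℝ)
    (m : Fin d → ℝ) : Set (Fin T → Fin d → Fin 2 → ℝ) :=
  {y | (∀ t s a, 0 ≤ y t s a) ∧
    (∀ (t : ℕ) (ht : t + 1 < T) (s : Fin d),
      y ⟨t + 1, ht⟩ s 0 + y ⟨t + 1, ht⟩ s 1 =
        ∑ s', ∑ a, y ⟨t, Nat.lt_of_succ_lt ht⟩ s' a * P a s' s) ∧
    (∀ t, ∑ s, y t s 1 = α) ∧
    (∀ (ht : 0 < T) (s : Fin d), y ⟨0, ht⟩ s 0 + y ⟨0, ht⟩ s 1 = m s)}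

/-- The objective of the finite-horizon relaxed LP. -/
def rbObjective (d T : ℕ) (R : Fin 2 → Fin d → ℝ)
    (y : Fin T → Fin d → Fin 2 → ℝ) : ℝ :=
  ∑ t, ∑ s, ∑ a, R a s * y t s a

/-- The optimal value `V_rel(m, T)` of the finite-horizon relaxed LP. -/
noncomputable def Vrel (d T : ℕ) (P : Fin 2 → Matrix (Fin d) (Fin d) ℝ)
    (R : Fin 2 → Fin d → ℝ) (α : ℝ) (m : Fin d → ℝ) : ℝ :=
  sSup (rbObjective d T R '' rbFeasible d T P α m)

lemma rb_step {d : ℕ} (α : ℝ) (hα : α ≤ 1) (m' : Fin d → ℝ) (y : Fin d → Fin 2 → ℝ) :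
    ∃ w : Fin d → Fin 2 → ℝ, (∀ s a, 0 ≤ y s a) → (∑ s, y s 1 = α) → (∀ s, 0 ≤ m' s) →
      (∑ s, m' s = 1) →
      ((∀ s a, 0 ≤ w s a) ∧ (∀ s, w s 0 + w s 1 = m' s) ∧ (∑ s, w s 1 = α) ∧
        ∑ s, ∑ a, |y s a - w s a| ≤ 5 * ∑ s, |y s 0 + y s 1 - m' s|) := by
  set z : Fin d → ℝ := fun s => min (y s 1) (m' s) with hz
  set ρ : ℝ := (α - ∑ s, z s) / (1 - ∑ s, z s) with hρ
  set v : Fin d → ℝ := fun s => z s + (m' s - z s) * ρ with hv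
  refine ⟨fun s a => if a = 0 then m' s - v s else v s, ?_⟩
  intro hy hys hm hms
  have hzm : ∀ s, z s ≤ m' s := fun s => min_le_right _ _
  have hzy : ∀ s, z s ≤ y s 1 := fun s => min_le_left _ _
  have hz0 : ∀ s, 0 ≤ z s := fun s => le_min (hy s 1) (hm s)
  have hzα : ∑ s, z s ≤ α := hys ▸ Finset.sum_le_sum fun s _ => hzy s
  have hρ0 : 0 ≤ ρ := div_nonneg (by linarith) (by linarith)
  have hρ1 : ρ ≤ 1 := div_le_one_of_le₀ (by linarith) (by linarith)
  have hρm : (1 - ∑ s, z s) * ρ = α - ∑ s, z s := by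
    by_cases h : 1 - ∑ s, z s = 0
    · rw [h]; linarith
    · rw [hρ]; field_simp
  have hsum : ∑ s, (m' s - z s) * ρ = α - ∑ s, z s := by
    rw [← Finset.sum_mul, Finset.sum_sub_distrib, hms, hρm]
  have hgap : ∀ s, y s 1 - z s ≤ |y s 0 + y s 1 - m' s| := by
    intro s
    have h0 := hy s 0
    rcases le_total (y s 1) (m' s) with h | h
    · simp only [hz, min_eq_left h]; simp
    · simp only [hz, min_eq_right h]
      exact le_trans (by linarith) (le_abs_self _)
  have hdef : α - ∑ s, z s ≤ ∑ s, |y s 0 + y s 1 - m' s| := by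
    rw [← hys, ← Finset.sum_sub_distrib]
    exact Finset.sum_le_sum fun s _ => hgap s
  have hc0 : ∀ s, 0 ≤ (m' s - z s) * ρ := fun s =>
    mul_nonneg (by linarith [hzm s]) hρ0
  have hc1 : ∀ s, (m' s - z s) * ρ ≤ m' s - z s := fun s =>
    mul_le_of_le_one_right (by linarith [hzm s]) hρ1
  refine ⟨?_, ?_, ?_, ?_⟩
  · intro s a
    by_cases h : a = 0
    · simp only [h, if_true, hv]; linarith [hc1 s]
    · simp only [h, if_false, hv]; linarith [hc0 s, hz0 s]
  · intro s; simp
  · simp only [one_ne_zero, if_false, hv, Finset.sum_add_distrib, hsum]; linarith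
  · have hpt : ∀ s, ∑ a, |y s a - (if a = 0 then m' s - v s else v s)|
        ≤ 3 * |y s 0 + y s 1 - m' s| + 2 * ((m' s - z s) * ρ) := by
      intro s
      have hg := hgap s
      have h1 : |y s 1 - v s| ≤ |y s 0 + y s 1 - m' s| + (m' s - z s) * ρ := by
        simp only [hv]
        rw [abs_le]
        constructor <;> linarith [hzy s, hc0 s, abs_nonneg (y s 0 + y s 1 - m' s)]
      have h0 : |y s 0 - (m' s - v s)| ≤ |y s 0 + y s 1 - m' s| + |y s 1 - v s| := by
        have e : y s 0 - (m' s - v s) = (y s 0 + y s 1 - m' s) - (y s 1 - v s) := by ring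
        rw [e]; exact abs_sub _ _
      simp only [Fin.sum_univ_two, if_true, one_ne_zero, if_false]
      linarith
    calc _ ≤ ∑ s, (3 * |y s 0 + y s 1 - m' s| + 2 * ((m' s - z s) * ρ)) :=
          Finset.sum_le_sum fun s _ => hpt s
      _ = 3 * ∑ s, |y s 0 + y s 1 - m' s| + 2 * (α - ∑ s, z s) := by
          rw [Finset.sum_add_distrib, ← Finset.mul_sum, ← Finset.mul_sum, hsum]
      _ ≤ _ := by linarith

lemma rb_flow_sum {d : ℕ} (P : Fin 2 → Matrix (Fin d) (Fin d) ℝ)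
    (hProw : ∀ a s, ∑ s', P a s s' = 1) (w : Fin d → Fin 2 → ℝ) :
    ∑ s, ∑ s', ∑ a, w s' a * P a s' s = ∑ s, (w s 0 + w s 1) := by
  rw [Finset.sum_comm]
  refine Finset.sum_congr rfl fun s _ => ?_
  rw [Finset.sum_comm, Fin.sum_univ_two, ← Finset.mul_sum, ← Finset.mul_sum, hProw, hProw]
  ring

lemma rb_flow_diff {d : ℕ} (P : Fin 2 → Matrix (Fin d) (Fin d) ℝ)
    (hPnn : ∀ a s s', 0 ≤ P a s s')
    (hProw : ∀ a s, ∑ s', P a s s' = 1) (y w : Fin d → Fin 2 → ℝ) :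
    ∑ s, |∑ s', ∑ a, y s' a * P a s' s - ∑ s', ∑ a, w s' a * P a s' s|
      ≤ ∑ s, ∑ a, |y s a - w s a| := by
  have h := rb_flow_sum P hProw (fun s a => |y s a - w s a|)
  simp only [Fin.sum_univ_two] at h ⊢
  rw [← h]
  refine Finset.sum_le_sum fun s _ => ?_
  rw [← Finset.sum_sub_distrib]
  refine (Finset.abs_sum_le_sum_abs _ _).trans (Finset.sum_le_sum fun s' _ => ?_)
  rw [← abs_of_nonneg (hPnn 0 s' s), ← abs_of_nonneg (hPnn 1 s' s), ← abs_mul, ← abs_mul,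
    abs_of_nonneg (hPnn 0 s' s), abs_of_nonneg (hPnn 1 s' s)]
  refine le_trans (le_of_eq ?_) (abs_add_le _ _)
  congr 1; ring

lemma rb_transfer {d T : ℕ} (hT : 1 ≤ T)
    (P : Fin 2 → Matrix (Fin d) (Fin d) ℝ)
    (hPnn : ∀ a s s', 0 ≤ P a s s')
    (hProw : ∀ a s, ∑ s', P a s s' = 1)
    (α : ℝ) (hα : α ≤ 1) (m m' : Fin d → ℝ)
    (hm' : ∀ s, 0 ≤ m' s) (hms' : ∑ s, m' s = 1)
    (y : Fin T → Fin d → Fin 2 → ℝ) (hy : y ∈ rbFeasible d T P α m) :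
    ∃ w ∈ rbFeasible d T P α m', ∀ t, ∑ s, ∑ a, |y t s a - w t s a|
      ≤ 5 ^ T * ∑ s, |m s - m' s| := by
  obtain ⟨hy0, hyf, hya, hyi⟩ := hy
  choose F hF using fun (m' : Fin d → ℝ) (y : Fin d → Fin 2 → ℝ) => rb_step α hα m' y
  let Y : ℕ → Fin d → Fin 2 → ℝ := fun t => if h : t < T then y ⟨t, h⟩ else 0
  have hY : ∀ t (h : t < T), Y t = y ⟨t, h⟩ := fun t h => by simp [Y, h]
  let q : ℕ → Fin d → Fin 2 → ℝ := fun t => Nat.rec (F m' (Y 0))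
    (fun t w => F (fun s => ∑ s', ∑ a, w s' a * P a s' s) (Y (t + 1))) t
  have hq0 : q 0 = F m' (Y 0) := rfl
  have hqs : ∀ t, q (t + 1) = F (fun s => ∑ s', ∑ a, q t s' a * P a s' s) (Y (t + 1)) :=
    fun t => rfl
  have hYn : ∀ t, t < T → (∀ s a, 0 ≤ Y t s a) := fun t h => by
    rw [hY t h]; exact hy0 _
  have hYa : ∀ t, t < T → ∑ s, Y t s 1 = α := fun t h => by
    rw [hY t h]; exact hya _
  have hflow : ∀ t, t < T → (∀ s a, 0 ≤ q t s a) → (∑ s, (q t s 0 + q t s 1) = 1) →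
      t + 1 < T → _ := fun t h h1 h2 h3 =>
    hF (fun s => ∑ s', ∑ a, q t s' a * P a s' s) (Y (t+1)) (hYn _ h3) (hYa _ h3)
      (fun s => Finset.sum_nonneg fun s' _ => Finset.sum_nonneg fun a _ =>
        mul_nonneg (h1 _ _) (hPnn _ _ _))
      (by rw [rb_flow_sum P hProw]; exact h2)
  have key : ∀ t, t < T → (∀ s a, 0 ≤ q t s a) ∧ (∑ s, (q t s 0 + q t s 1) = 1) ∧
      (∑ s, q t s 1 = α) ∧
      ∑ s, ∑ a, |Y t s a - q t s a| ≤ 5 ^ (t + 1) * ∑ s, |m s - m' s| := by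
    intro t
    induction t with
    | zero =>
      intro h
      obtain ⟨h1, h2, h3, h4⟩ := hF m' (Y 0) (hYn _ h) (hYa _ h) hm' hms'
      rw [hq0]
      refine ⟨h1, by simp only [h2, hms'], h3, ?_⟩
      refine h4.trans (le_of_eq ?_)
      simp only [hY 0 h, hyi, zero_add, pow_one]
    | succ t ih =>
      intro h
      have ht : t < T := by omega
      obtain ⟨i1, i2, i3, i4⟩ := ih ht
      obtain ⟨h1, h2, h3, h4⟩ := hflow t ht i1 i2 h
      rw [hqs]
      refine ⟨h1, ?_, h3, h4.trans ?_⟩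
      · simp only [h2]; rw [rb_flow_sum P hProw]; exact i2
      · have e : ∀ s, Y (t+1) s 0 + Y (t+1) s 1 = ∑ s', ∑ a, Y t s' a * P a s' s := by
          intro s; rw [hY _ h, hY _ ht]; exact hyf t h s
        simp only [e]
        have := rb_flow_diff P hPnn hProw (Y t) (q t)
        rw [pow_succ]; linarith
  refine ⟨fun t => q t, ⟨fun t s a => (key t t.2).1 s a, ?_, fun t => (key t t.2).2.2.1, ?_⟩, ?_⟩
  · intro t ht s
    have ht' : t < T := by omega
    obtain ⟨i1, i2, i3, i4⟩ := key t ht'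
    exact (hflow t ht' i1 i2 ht).2.1 s
  · intro h s
    exact (hF m' (Y 0) (hYn _ h) (hYa _ h) hm' hms').2.1 s
  · intro t
    have := (key t t.2).2.2.2
    rw [hY _ t.2] at this
    refine this.trans (mul_le_mul_of_nonneg_right ?_ (Finset.sum_nonneg fun s _ => abs_nonneg _))
    exact pow_le_pow_right₀ (by norm_num) t.2

lemma rb_obj_diff {d T : ℕ} (R : Fin 2 → Fin d → ℝ) (y w : Fin T → Fin d → Fin 2 → ℝ)
    (C : ℝ) (h : ∀ t, ∑ s, ∑ a, |y t s a - w t s a| ≤ C) :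
    rbObjective d T R y - rbObjective d T R w ≤ T * ((∑ s, ∑ a, |R a s|) * C) := by
  have hR : ∀ s a, |R a s| ≤ ∑ s, ∑ a, |R a s| := fun s a =>
    (Finset.single_le_sum (f := fun a => |R a s|) (fun a _ => abs_nonneg _)
      (Finset.mem_univ a)).trans
    (Finset.single_le_sum (f := fun s => ∑ a, |R a s|)
      (fun s _ => Finset.sum_nonneg fun a _ => abs_nonneg _) (Finset.mem_univ s))
  have hB : 0 ≤ ∑ s, ∑ a, |R a s| :=
    Finset.sum_nonneg fun s _ => Finset.sum_nonneg fun a _ => abs_nonneg _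
  unfold rbObjective
  simp only [← Finset.sum_sub_distrib]
  refine (Finset.sum_le_card_nsmul _ _ ((∑ s, ∑ a, |R a s|) * C) fun t _ => ?_).trans
    (by simp)
  refine le_trans ?_ (mul_le_mul_of_nonneg_left (h t) hB)
  rw [Finset.mul_sum]
  refine Finset.sum_le_sum fun s _ => ?_
  rw [Finset.mul_sum]
  refine Finset.sum_le_sum fun a _ => ?_
  rw [← mul_sub]
  refine (le_abs_self _).trans ?_
  rw [abs_mul]
  exact mul_le_mul_of_nonneg_right (hR s a) (abs_nonneg _)

lemma rb_bdd {d T : ℕ} (P : Fin 2 → Matrix (Fin d) (Fin d) ℝ)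
    (hProw : ∀ a s, ∑ s', P a s s' = 1) (R : Fin 2 → Fin d → ℝ)
    (α : ℝ) (m : Fin d → ℝ) (hms : ∑ s, m s = 1) :
    BddAbove (rbObjective d T R '' rbFeasible d T P α m) := by
  refine ⟨T * ((∑ s, ∑ a, |R a s|) * 1), ?_⟩
  rintro _ ⟨y, ⟨hy0, hyf, hya, hyi⟩, rfl⟩
  have hmass : ∀ t (h : t < T), ∑ s, (y ⟨t, h⟩ s 0 + y ⟨t, h⟩ s 1) = 1 := by
    intro t
    induction t with
    | zero => intro h; simp only [hyi, hms]
    | succ t ih =>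
      intro h
      simp only [hyf t h]
      rw [rb_flow_sum P hProw]; exact ih _
  have := rb_obj_diff R y (fun _ _ _ => 0) 1 (fun t => by
    refine le_of_eq (Eq.trans ?_ (hmass t t.2))
    refine Finset.sum_congr rfl fun s _ => ?_
    simp [Fin.sum_univ_two, abs_of_nonneg (hy0 t s _)])
  have h0 : rbObjective d T R (fun _ _ _ => 0) = 0 := by simp [rbObjective]
  linarith

/-- The optimal value `V_rel(·, T)` of the finite-horizon relaxed
LP is Lipschitz continuous in the initial configuration on the simplex, with respect
to the L1 norm. -/
theorem Vrel_lipschitz_in_initial_configuration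
    (d T : ℕ) (hd : 1 ≤ d) (hT : 1 ≤ T)
    (P : Fin 2 → Matrix (Fin d) (Fin d) ℝ)
    (hPnn : ∀ a s s', 0 ≤ P a s s')
    (hProw : ∀ a s, ∑ s', P a s s' = 1)
    (R : Fin 2 → Fin d → ℝ)
    (α : ℝ) (hα : α ∈ Set.Icc (0 : ℝ) 1) :
    ∃ K > (0 : ℝ), ∀ m m' : Fin d → ℝ,
      (∀ s, 0 ≤ m s) → (∑ s, m s = 1) →
      (∀ s, 0 ≤ m' s) → (∑ s, m' s = 1) →
      |Vrel d T P R α m - Vrel d T P R α m'| ≤ K * ∑ s, |m s - m' s| := by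
  have hB : 0 ≤ ∑ s, ∑ a, |R a s| :=
    Finset.sum_nonneg fun s _ => Finset.sum_nonneg fun a _ => abs_nonneg _
  set K : ℝ := T * ((∑ s, ∑ a, |R a s|) * 5 ^ T) with hK
  have hK0 : 0 ≤ K := by positivity
  have one : ∀ m m' : Fin d → ℝ,
      (∀ s, 0 ≤ m s) → (∑ s, m s = 1) →
      (∀ s, 0 ≤ m' s) → (∑ s, m' s = 1) →
      Vrel d T P R α m - Vrel d T P R α m' ≤ K * ∑ s, |m s - m' s| := by
    intro m m' hm hms hm' hms'
    have hD : 0 ≤ ∑ s, |m s - m' s| := Finset.sum_nonneg fun s _ => abs_nonneg _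
    rcases (rbFeasible d T P α m).eq_empty_or_nonempty with he | hne
    · have he' : rbFeasible d T P α m' = ∅ := by
        rw [Set.eq_empty_iff_forall_notMem]
        intro y hy
        obtain ⟨w, hw, -⟩ := rb_transfer hT P hPnn hProw α hα.2 m' m hm hms y hy
        rw [he] at hw
        exact hw
      simp only [Vrel, he, he', sub_self]
      positivity
    · have : Vrel d T P R α m ≤ Vrel d T P R α m' + K * ∑ s, |m s - m' s| := by
        refine csSup_le (hne.image _) ?_
        rintro _ ⟨y, hy, rfl⟩
        obtain ⟨w, hw, hyw⟩ := rb_transfer hT P hPnn hProw α hα.2 m m' hm' hms' y hy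
        have h1 := rb_obj_diff R y w _ hyw
        have h2 : rbObjective d T R w ≤ Vrel d T P R α m' :=
          le_csSup (rb_bdd P hProw R α m' hms') ⟨w, hw, rfl⟩
        have h3 : T * ((∑ s, ∑ a, |R a s|) * (5 ^ T * ∑ s, |m s - m' s|))
            = K * ∑ s, |m s - m' s| := by rw [hK]; ring
        linarith
      linarith
  refine ⟨K + 1, by linarith, ?_⟩
  intro m m' hm hms hm' hms'
  have h1 := one m m' hm hms hm' hms'
  have h2 := one m' m hm' hms' hm hms
  have hD : 0 ≤ ∑ s, |m s - m' s| := Finset.sum_nonneg fun s _ => abs_nonneg _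
  simp only [abs_sub_comm (m' _) (m _)] at h2
  rw [abs_le]
  constructor <;> linarith
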